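/- arXiv:2401.01760 — 2 statements merged into one kernel-verified Lean document; each statement's English description precedes it below -/
import Mathlib

section
/- For every n ≥ 1 and every real number x: Σ_{π ∈ S_n} x^{êxc(π)+f̂ix(π)} = Σ_{π ∈ S_n} x^{asc(π)}; that is, êxc + f̂ix is equidistributed with the ascent statistic over S_n (it is an Eulerian statistic). -/
open Finset

namespace SucEuler

/-- One-line notation word of a permutation: `word π i` is the value (in `1..n`)
at position `i ∈ {1,…,n}`, and `0` for positions outside `{1,…,n}`
(this implements the conventions `π(0)=π(n+1)=0`). -/
def word {n : ℕ} (π : Equiv.Perm (Fin n)) (i : ℕ) : ℕ :=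
  if h : 1 ≤ i ∧ i ≤ n then ((π ⟨i - 1, by omega⟩ : Fin n) : ℕ) + 1 else 0

/-- number of descents -/
def des {n : ℕ} (π : Equiv.Perm (Fin n)) : ℕ :=
  ((Finset.Icc 1 (n - 1)).filter fun i => word π (i + 1) < word π i).card

/-- number of ascents -/
def asc {n : ℕ} (π : Equiv.Perm (Fin n)) : ℕ :=
  ((Finset.Icc 1 (n - 1)).filter fun i => word π i < word π (i + 1)).card

/-- number of successions -/
def suc {n : ℕ} (π : Equiv.Perm (Fin n)) : ℕ :=
  ((Finset.Icc 1 (n - 1)).filter fun i => word π (i + 1) = word π i + 1).card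

/-- number of big ascents -/
def basc {n : ℕ} (π : Equiv.Perm (Fin n)) : ℕ :=
  ((Finset.Icc 1 (n - 1)).filter fun i => word π i + 2 ≤ word π (i + 1)).card

/-- number of excedances -/
def excStat {n : ℕ} (σ : Equiv.Perm (Fin n)) : ℕ :=
  (Finset.univ.filter fun i : Fin n => i < σ i).card

/-- number of fixed points -/
def fixStat {n : ℕ} (σ : Equiv.Perm (Fin n)) : ℕ :=
  (Finset.univ.filter fun i : Fin n => σ i = i).card

/-- number of drops -/
def dropStat {n : ℕ} (σ : Equiv.Perm (Fin n)) : ℕ :=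
  (Finset.univ.filter fun i : Fin n => σ i < i).card

/-- number of excedances at positions `i ≥ 2` -/
def excHat {n : ℕ} (σ : Equiv.Perm (Fin n)) : ℕ :=
  (Finset.univ.filter fun i : Fin n => 0 < (i : ℕ) ∧ i < σ i).card

/-- number of fixed points other than `1` -/
def fixHat {n : ℕ} (σ : Equiv.Perm (Fin n)) : ℕ :=
  (Finset.univ.filter fun i : Fin n => 0 < (i : ℕ) ∧ σ i = i).card

/-- number of cycles (orbits) of a permutation -/
def cyc {n : ℕ} (σ : Equiv.Perm (Fin n)) : ℕ :=
  σ.cycleType.card + fixStat σ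

/-- number of cycle double ascents: values `x` with `σ⁻¹(x) < x < σ(x)` -/
def cda {n : ℕ} (σ : Equiv.Perm (Fin n)) : ℕ :=
  (Finset.univ.filter fun x : Fin n => σ⁻¹ x < x ∧ x < σ x).card

open Classical in
/-- number of left-to-right minima -/
noncomputable def lrmin {n : ℕ} (π : Equiv.Perm (Fin n)) : ℕ :=
  ((Finset.Icc 1 n).filter fun i => ∀ j ∈ Finset.Icc 1 n, j < i → word π i < word π j).card

open Classical in
/-- number of proper left-to-right minima -/
noncomputable def plrmin {n : ℕ} (π : Equiv.Perm (Fin n)) : ℕ :=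
  ((Finset.Icc 1 n).filter fun i =>
    (∀ j ∈ Finset.Icc 1 n, j < i → word π i < word π j) ∧ word π i ≠ 1 ∧
      ∃ k ∈ Finset.Icc 1 n, i < k ∧ word π k = word π i - 1 ∧ word π (k + 1) < word π k).card

open Classical in
/-- number of simsun successions -/
noncomputable def simsuc {n : ℕ} (π : Equiv.Perm (Fin n)) : ℕ :=
  ((Finset.Icc 1 n).filter fun i =>
    ∃ j ∈ Finset.Icc 1 n, i < j ∧ word π j = word π i + 1 ∧
      ∀ k ∈ Finset.Icc 1 n, i < k → k < j → word π i + 1 < word π k).card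

/-- number of peaks (with the boundary conventions `π(0)=π(n+1)=0`) -/
def pk {n : ℕ} (π : Equiv.Perm (Fin n)) : ℕ :=
  ((Finset.Icc 1 n).filter fun i => word π (i - 1) < word π i ∧ word π (i + 1) < word π i).card

/-- number of valleys -/
def valStat {n : ℕ} (π : Equiv.Perm (Fin n)) : ℕ :=
  ((Finset.Icc 1 n).filter fun i => word π i < word π (i - 1) ∧ word π i < word π (i + 1)).card

/-- number of double ascents -/
def dasc {n : ℕ} (π : Equiv.Perm (Fin n)) : ℕ :=
  ((Finset.Icc 1 n).filter fun i => word π (i - 1) < word π i ∧ word π i < word π (i + 1)).card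

/-- number of double descents -/
def ddes {n : ℕ} (π : Equiv.Perm (Fin n)) : ℕ :=
  ((Finset.Icc 1 n).filter fun i => word π (i + 1) < word π i ∧ word π i < word π (i - 1)).card

open Classical in
/-- `nextVal σ m x` is the (0-indexed) first value `≤ m` (i.e. `< m` in 0-indexed terms)
in the forward orbit of `x` under `σ`: it equals `σ^t(x)` for the minimal `t ≥ 1`
with `σ^t(x) < m`, when such `t` exists. This is the action of the permutation `σ_k`
(with `m = n - k`) obtained by removing the `k` largest letters from the cycles of `σ`. -/
noncomputable def nextVal {n : ℕ} (σ : Equiv.Perm (Fin n)) (m : ℕ) (x : Fin n) : ℕ :=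
  if h : ∃ t : ℕ, 0 < t ∧ (((σ ^ t) x : Fin n) : ℕ) < m then (((σ ^ Nat.find h) x : Fin n) : ℕ)
  else 0

/-- `σ` is a simsun permutation of the second kind: for every `0 ≤ k ≤ n-1`, the
permutation of `[n-k]` obtained from `σ` by removing the `k` largest letters has
no cycle double ascents. (Here `m = n - k` and values are 0-indexed.) -/
def IsSimsun2 {n : ℕ} (σ : Equiv.Perm (Fin n)) : Prop :=
  ∀ m ≤ n, ∀ x : Fin n, (x : ℕ) < m →
    ¬ (nextVal σ⁻¹ m x < (x : ℕ) ∧ (x : ℕ) < nextVal σ m x)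

noncomputable instance {n : ℕ} : DecidablePred (IsSimsun2 (n := n)) :=
  fun _ => Classical.propDecidable _

/-- the derangement polynomial `d_n(x)` -/
def dpoly (n : ℕ) (x : ℝ) : ℝ :=
  ∑ σ ∈ Finset.univ.filter fun σ : Equiv.Perm (Fin n) => fixStat σ = 0, x ^ excStat σ

/-- the Eulerian polynomial `A_n(x)` -/
def eulerian (n : ℕ) (x : ℝ) : ℝ :=
  ∑ π : Equiv.Perm (Fin n), x ^ des π



/-- step function -/
def stp (n : ℕ) (φ : ℕ → ℝ) (k : ℕ) : ℝ := ((n : ℝ) - k) * φ (k + 1) + (k + 1) * φ k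

def wst {n : ℕ} (e : Equiv.Perm (Fin n)) : ℕ := ∑ i : Fin n, if i ≤ e i then 1 else 0

lemma hat_eq {n : ℕ} (e : Equiv.Perm (Fin n)) :
    excHat e + fixHat e = ∑ i : Fin n, if 0 < (i : ℕ) ∧ i ≤ e i then 1 else 0 := by
  unfold excHat fixHat
  rw [Finset.card_filter, Finset.card_filter, ← Finset.sum_add_distrib]
  refine Finset.sum_congr rfl fun i _ => ?_
  rcases lt_trichotomy i (e i) with h | h | h
  · simp [h, h.le, h.ne']
  · simp [← h]
  · simp [h.not_ge, h.not_gt, h.ne]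

lemma wst_eq {m : ℕ} (e : Equiv.Perm (Fin (m + 1))) : wst e = excHat e + fixHat e + 1 := by
  rw [hat_eq, wst, Fin.sum_univ_succ, Fin.sum_univ_succ]
  simp [add_comm]

lemma hat_zero {m : ℕ} (e : Equiv.Perm (Fin m)) :
    excHat (Equiv.Perm.decomposeFin.symm (0, e)) + fixHat (Equiv.Perm.decomposeFin.symm (0, e))
      = wst e := by
  rw [hat_eq, wst, Fin.sum_univ_succ]
  simp

lemma hat_succ {m : ℕ} (e : Equiv.Perm (Fin m)) (j : Fin m) :
    excHat (Equiv.Perm.decomposeFin.symm (j.succ, e)) +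
      fixHat (Equiv.Perm.decomposeFin.symm (j.succ, e)) + (if e.symm j ≤ j then 1 else 0)
      = wst e := by
  rw [hat_eq, wst, Fin.sum_univ_succ]
  have h : ∀ i : Fin m, (if i ≤ e i then 1 else 0 : ℕ) =
      (if 0 < ((i.succ : Fin (m+1)) : ℕ) ∧
        i.succ ≤ Equiv.Perm.decomposeFin.symm (j.succ, e) i.succ then 1 else 0) +
      (if i = e.symm j then (if e.symm j ≤ j then 1 else 0) else 0) := by
    intro i
    rw [Equiv.Perm.decomposeFin_symm_apply_succ]
    by_cases hi : i = e.symm j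
    · subst hi
      simp
    · have : e i ≠ j := fun h => hi (by simp [← h])
      rw [Equiv.swap_apply_of_ne_of_ne (Fin.succ_ne_zero _) (by simpa using this)]
      simp [hi]
  rw [Finset.sum_congr rfl fun i _ => h i, Finset.sum_add_distrib]
  simp

/-- the two-valued sum -/
lemma sum_two {ι : Type*} (s : Finset ι) (P : ι → Prop) [DecidablePred P] (a b : ℝ) :
    ∑ i ∈ s, (if P i then a else b) =
      ((∑ i ∈ s, if P i then 1 else 0 : ℕ) : ℝ) * a +
        ((s.card : ℝ) - ((∑ i ∈ s, if P i then 1 else 0 : ℕ) : ℝ)) * b := by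
  have : ∀ i ∈ s, (if P i then a else b) = (if P i then 1 else 0 : ℝ) * (a - b) + b := by
    intro i _; split_ifs <;> ring
  rw [Finset.sum_congr rfl this, Finset.sum_add_distrib, ← Finset.sum_mul]
  push_cast
  simp only [Finset.sum_const, nsmul_eq_mul]
  ring

lemma hat_rec {m : ℕ} (φ : ℕ → ℝ) :
    ∑ π : Equiv.Perm (Fin (m + 2)), φ (excHat π + fixHat π) =
      ∑ e : Equiv.Perm (Fin (m + 1)), stp (m + 1) φ (excHat e + fixHat e) := by
  rw [← Equiv.sum_comp Equiv.Perm.decomposeFin.symm, Fintype.sum_prod_type_right]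
  refine Finset.sum_congr rfl fun e _ => ?_
  rw [Fin.sum_univ_succ, hat_zero, wst_eq]
  have h : ∀ j : Fin (m+1), φ (excHat (Equiv.Perm.decomposeFin.symm (j.succ, e)) +
      fixHat (Equiv.Perm.decomposeFin.symm (j.succ, e))) =
      if e.symm j ≤ j then φ (excHat e + fixHat e) else φ (excHat e + fixHat e + 1) := by
    intro j
    have := hat_succ e j
    rw [wst_eq] at this
    split_ifs at this ⊢ <;> congr 1
    omega
  rw [Finset.sum_congr rfl fun j _ => h j, sum_two]
  have h2 : (∑ j : Fin (m+1), if e.symm j ≤ j then 1 else 0 : ℕ) = excHat e + fixHat e + 1 := by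
    rw [← wst_eq, wst, ← Equiv.sum_comp e]
    simp
  rw [h2, stp]
  simp
  ring

/-- insert the maximal value at position `p` -/
def ins {n : ℕ} (q : Fin (n + 1) × Equiv.Perm (Fin n)) : Equiv.Perm (Fin (n + 1)) :=
  (finSuccEquiv' q.1).trans ((Equiv.optionCongr q.2).trans (finSuccEquiv' (Fin.last n)).symm)

lemma ins_same {n : ℕ} (p : Fin (n + 1)) (e : Equiv.Perm (Fin n)) :
    ins (p, e) p = Fin.last n := by
  simp [ins]

lemma ins_above {n : ℕ} (p : Fin (n + 1)) (e : Equiv.Perm (Fin n)) (i : Fin n) :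
    ins (p, e) (p.succAbove i) = (e i).castSucc := by
  simp [ins]

lemma ins_bij {n : ℕ} : Function.Bijective (ins (n := n)) := by
  rw [Fintype.bijective_iff_injective_and_card]
  constructor
  · rintro ⟨p, e⟩ ⟨p', e'⟩ h
    have hp : p = p' := by
      apply (ins (p', e')).injective
      rw [ins_same, ← h, ins_same]
    subst hp
    congr 1
    ext i
    have := ins_above p e i
    rw [h, ins_above] at this
    simpa using congrArg Fin.val this.symm
  · simp [Fintype.card_perm, Nat.factorial_succ]

def asx {n : ℕ} (e : Equiv.Perm (Fin n)) : ℕ :=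
  ∑ i ∈ range (n + 1), if word e i < word e (i + 1) then 1 else 0

lemma asx_eq {m : ℕ} (e : Equiv.Perm (Fin (m + 1))) : asx e = asc e + 1 := by
  unfold asx asc
  rw [Finset.card_filter, Finset.sum_range_succ, Finset.sum_range_succ']
  have h1 : word e 0 < word e (0 + 1) := by simp [word]
  have h2 : ¬ word e (m + 1) < word e (m + 1 + 1) := by simp [word]
  rw [if_pos h1, if_neg h2, Finset.range_eq_Ico, Finset.sum_Ico_add' (fun i => if word e i < word e (i+1) then 1 else 0) 0 m 1]
  rw [add_zero]
  congr 1

lemma word_le {n : ℕ} (e : Equiv.Perm (Fin n)) (i : ℕ) : word e i ≤ n := by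
  unfold word; split_ifs
  · exact (e _).isLt
  · omega

lemma word_ins_lt {n : ℕ} (p : Fin (n + 1)) (e : Equiv.Perm (Fin n)) (i : ℕ) (h : i ≤ p) :
    word (ins (p, e)) i = word e i := by
  unfold word
  by_cases hi : 1 ≤ i
  · have hp := p.isLt
    rw [dif_pos ⟨hi, by omega⟩, dif_pos ⟨hi, by omega⟩]
    have := ins_above p e ⟨i - 1, by omega⟩
    rw [Fin.succAbove_of_castSucc_lt _ _ (by rw [Fin.lt_def]; simp; omega)] at this
    have h2 := congrArg Fin.val this
    simpa using h2
  · rw [dif_neg (by omega), dif_neg (by omega)]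

lemma word_ins_eq {n : ℕ} (p : Fin (n + 1)) (e : Equiv.Perm (Fin n)) :
    word (ins (p, e)) (p + 1) = n + 1 := by
  unfold word
  have hp := p.isLt
  rw [dif_pos ⟨by omega, by omega⟩]
  have h2 := congrArg Fin.val (ins_same p e)
  simpa using h2

lemma word_ins_gt {n : ℕ} (p : Fin (n + 1)) (e : Equiv.Perm (Fin n)) (i : ℕ) (h : p < i) :
    word (ins (p, e)) (i + 1) = word e i := by
  unfold word
  by_cases hi : i ≤ n
  · rw [dif_pos ⟨by omega, by omega⟩, dif_pos ⟨by omega, hi⟩]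
    have := ins_above p e ⟨i - 1, by omega⟩
    rw [Fin.succAbove_of_le_castSucc _ _ (by rw [Fin.le_def]; simp; omega)] at this
    have h2 := congrArg Fin.val this
    have h3 : i - 1 + 1 = i := by omega
    simpa [h3] using h2
  · rw [dif_neg (by omega), dif_neg (by omega)]

lemma asx_ins {n : ℕ} (p : Fin (n + 1)) (e : Equiv.Perm (Fin n)) :
    asx (ins (p, e)) + (if word e p < word e (p + 1) then 1 else 0) = asx e + 1 := by
  obtain ⟨q, hq⟩ : ∃ q, n + 1 = (p + 1 : ℕ) + q := ⟨n - p, by have := p.isLt; omega⟩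
  unfold asx
  have hq2 : n + 1 + 1 = (p + 1 + 1 : ℕ) + q := by omega
  have r1 : range (n + 1) = range ((p + 1 : ℕ) + q) := congrArg range hq
  rw [hq2, r1, Finset.sum_range_add _ (p + 1 + 1 : ℕ) q, Finset.sum_range_add _ (p + 1 : ℕ) q, Finset.sum_range_succ,
    Finset.sum_range_succ, Finset.sum_range_succ]
  have a1 : word (ins (p, e)) p < word (ins (p, e)) (p + 1) := by
    rw [word_ins_eq]
    rw [word_ins_lt _ _ _ le_rfl]
    have := word_le e p
    omega
  have a2 : ¬ word (ins (p, e)) (p + 1) < word (ins (p, e)) (p + 1 + 1) := by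
    rw [word_ins_eq]
    have := word_le (ins (p, e)) (p + 1 + 1)
    omega
  rw [if_pos a1, if_neg a2]
  have b1 : ∑ i ∈ range (p : ℕ), (if word (ins (p, e)) i < word (ins (p, e)) (i + 1) then 1 else 0)
      = ∑ i ∈ range (p : ℕ), (if word e i < word e (i + 1) then 1 else 0) := by
    refine Finset.sum_congr rfl fun i hi => ?_
    rw [Finset.mem_range] at hi
    rw [word_ins_lt _ _ _ hi.le, word_ins_lt _ _ _ hi]
  have b2 : ∑ i ∈ range q, (if word (ins (p, e)) (p + 1 + 1 + i) <
        word (ins (p, e)) (p + 1 + 1 + i + 1) then 1 else 0)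
      = ∑ i ∈ range q, (if word e (p + 1 + i) < word e (p + 1 + i + 1) then 1 else 0) := by
    refine Finset.sum_congr rfl fun i hi => ?_
    rw [show (p + 1 + 1 + i : ℕ) = p + 1 + i + 1 by omega,
      word_ins_gt _ _ _ (by omega), word_ins_gt _ _ _ (by omega)]
  rw [b1, b2]
  omega

lemma asc_rec {m : ℕ} (φ : ℕ → ℝ) :
    ∑ π : Equiv.Perm (Fin (m + 2)), φ (asc π) =
      ∑ e : Equiv.Perm (Fin (m + 1)), stp (m + 1) φ (asc e) := by
  rw [← ins_bij.sum_comp, Fintype.sum_prod_type_right]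
  refine Finset.sum_congr rfl fun e _ => ?_
  have h : ∀ p : Fin (m + 2), φ (asc (ins (p, e))) =
      if word e p < word e (p + 1) then φ (asc e) else φ (asc e + 1) := by
    intro p
    have := asx_ins p e
    rw [asx_eq, asx_eq] at this
    split_ifs at this ⊢ <;> congr 1 <;> omega
  rw [Finset.sum_congr rfl fun j _ => h j, sum_two]
  have h2 : (∑ p : Fin (m + 2), if word e p < word e (p + 1) then 1 else 0 : ℕ) = asc e + 1 := by
    rw [← asx_eq, asx, Finset.sum_range]
  rw [h2, stp]
  simp
  ring

lemma main_gen (m : ℕ) : ∀ φ : ℕ → ℝ,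
    ∑ π : Equiv.Perm (Fin (m + 1)), φ (excHat π + fixHat π) =
      ∑ π : Equiv.Perm (Fin (m + 1)), φ (asc π) := by
  induction m with
  | zero =>
    intro φ
    refine Finset.sum_congr rfl fun e _ => ?_
    have h1 := wst_eq e
    have h2 : asc e = 0 := by simp [asc]
    have h3 : wst e = 1 := by simp [wst]
    have h4 : excHat e + fixHat e = 0 := by omega
    rw [h2, h4]
  | succ m ih =>
    intro φ
    rw [hat_rec, asc_rec, ih]

/-- `êxc + f̂ix` is equidistributed with `asc` over `S_n`. -/
theorem statement2 (n : ℕ) (hn : 1 ≤ n) (x : ℝ) :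
    ∑ π : Equiv.Perm (Fin n), x ^ (excHat π + fixHat π) =
      ∑ π : Equiv.Perm (Fin n), x ^ asc π := by
  obtain ⟨m, rfl⟩ : ∃ m, n = m + 1 := ⟨n - 1, by omega⟩
  exact main_gen m fun k => x ^ k

end SucEuler
end

section
/- For every n ≥ 0 and all real numbers x, y: Σ_{π ∈ S_{n+1}} x^{basc(π)} y^{des(π)} (−y)^{suc(π)} = Σ_{σ ∈ SS_n, fix(σ)=0} (2xy)^{exc(σ)} (x+y)^{n − 2·exc(σ)}. -/
open Finset

namespace SucEuler

/-! ### Lists -/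

def gw {R : Type*} (x y s : R) (a b : ℕ) : R :=
  if b < a then y else if b = a + 1 then s else x

def lw {R : Type*} [CommRing R] (x y s : R) : List ℕ → R
  | [] => 1
  | [_] => 1
  | a :: b :: l => gw x y s a b * lw x y s (b :: l)

def dl : ℕ → List ℕ
  | 0 => []
  | n + 1 => n :: dl n

theorem mem_dl (n k : ℕ) : k ∈ dl n ↔ k < n := by
  induction n with
  | zero => simp [dl]
  | succ n ih => simp [dl, ih]; omega

theorem nodup_dl (n : ℕ) : (dl n).Nodup := by
  induction n with
  | zero => simp [dl]
  | succ n ih => simp [dl, ih, mem_dl]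

theorem length_dl (n : ℕ) : (dl n).length = n := by
  induction n with
  | zero => simp [dl]
  | succ n ih => simp [dl, ih]

section ring
variable {R : Type*} [CommRing R] [Algebra ℝ R] (D : Derivation ℝ R R) (x y s : R)

theorem D_gw (hx : D x = x * y) (hy : D y = x * y) (hs : D s = x * y) (a b : ℕ) :
    D (gw x y s a b) = x * y := by
  unfold gw; split_ifs <;> assumption

theorem ins_tail (hx : D x = x * y) (hy : D y = x * y) (hs : D s = x * y) (m : ℕ) :
    ∀ (l : List ℕ) (a : ℕ), (a :: l).Nodup → (∀ k ∈ a :: l, k < m + 1) →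
      (((List.permutations'Aux (m + 1) l).map (List.cons a)).map (lw x y s)).sum
        = D (lw x y s (a :: l)) + (if m ∈ a :: l then s else x) * lw x y s (a :: l) := by
  intro l
  induction l with
  | nil =>
    intro a _ h
    have := h a (by simp)
    simp only [List.permutations'Aux, List.map_cons, List.map_nil, List.sum_cons, List.sum_nil,
      lw, gw, List.mem_singleton]
    rw [if_neg (by omega)]
    by_cases h1 : m = a
    · simp [h1]
    · rw [if_neg (by omega), if_neg h1]; simp
  | cons b l ih =>
    intro a hnd h
    have ha := h a (by simp)
    have hb := h b (by simp)
    have ih' := ih b (List.nodup_cons.1 hnd).2 (fun k hk => h k (List.mem_cons_of_mem _ hk))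
    have hab : a ≠ b := by
      rintro rfl; simp at hnd
    have hnot := (List.nodup_cons.1 hnd).1
    have key : ∀ L : List (List ℕ),
        ((((L.map (List.cons b)).map (List.cons a))).map (lw x y s)).sum
          = gw x y s a b * ((L.map (List.cons b)).map (lw x y s)).sum := by
      intro L
      induction L with
      | nil => simp
      | cons c L ihL => simp only [List.map_cons, List.sum_cons, ihL, lw]; ring
    simp only [List.permutations'Aux, List.map_cons, List.sum_cons]
    rw [key, ih']
    simp only [lw]
    rw [D.leibniz, D_gw D x y s hx hy hs]
    have e1 : gw x y s (m+1) b = y := by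
      unfold gw; rw [if_pos (by omega)]
    rw [e1]
    simp only [smul_eq_mul]
    by_cases h1 : a = m
    · subst h1
      have e2 : gw x y s a (a+1) = s := by simp [gw]
      have e3 : gw x y s a b = y := by unfold gw; rw [if_pos (by omega)]
      rw [e2, e3, if_neg hnot, if_pos (by simp)]
      ring
    · have e2 : gw x y s a (m+1) = x := by
        unfold gw; rw [if_neg (by omega), if_neg (by omega)]
      have e4 : (m ∈ a :: b :: l) ↔ (m ∈ b :: l) := by
        rw [List.mem_cons]; constructor
        · rintro (h | h)
          · exact absurd h.symm h1
          · exact h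
        · exact Or.inr
      rw [e2]
      simp only [e4]
      ring

def LP (n : ℕ) : R := (((dl n).permutations').map (lw x y s)).sum

theorem LP_rec (hx : D x = x * y) (hy : D y = x * y) (hs : D s = x * y) (m : ℕ) :
    LP x y s (m + 2) = D (LP x y s (m + 1)) + (y + s) * LP x y s (m + 1) := by
  have key : ∀ L : List (List ℕ), (∀ l ∈ L, l.Perm (dl (m+1))) →
      ((L.flatMap (List.permutations'Aux (m+1))).map (lw x y s)).sum
       = D ((L.map (lw x y s)).sum) + (y + s) * (L.map (lw x y s)).sum := by
    intro L
    induction L with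
    | nil => simp
    | cons c L ih =>
      intro h
      have h1 := h c (by simp)
      have ih' := ih (fun l hl => h l (List.mem_cons_of_mem _ hl))
      simp only [List.flatMap_cons, List.map_append, List.sum_append, List.map_cons, List.sum_cons,
        ih', map_add]
      have hlt : ∀ k ∈ c, k < m + 1 := fun k hk => (mem_dl _ _).1 (h1.mem_iff.1 hk)
      have hnd : c.Nodup := h1.nodup_iff.2 (nodup_dl _)
      have hm : m ∈ c := h1.mem_iff.2 ((mem_dl _ _).2 (by omega))
      cases c with
      | nil => simp at hm
      | cons a l =>
        have := ins_tail D x y s hx hy hs m l a hnd hlt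
        rw [if_pos hm] at this
        simp only [List.permutations'Aux, List.map_cons, List.sum_cons, this, lw]
        have e1 : gw x y s (m+1) a = y := by
          have := hlt a (by simp)
          unfold gw; rw [if_pos (by omega)]
        rw [e1]; ring
  exact key _ (fun l hl => List.mem_permutations'.1 hl)

theorem lw_eq_prod (l : List ℕ) : lw x y s l =
    ∏ i ∈ Finset.range (l.length - 1), gw x y s (l.getD i 0) (l.getD (i+1) 0) := by
  induction l with
  | nil => simp [lw]
  | cons a l ih =>
    cases l with
    | nil => simp [lw]
    | cons b l =>
      rw [lw, ih]
      simp only [List.length_cons, Nat.add_sub_cancel]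
      rw [Finset.prod_range_succ' _ l.length]
      simp [mul_comm]

def toL {n : ℕ} (π : Equiv.Perm (Fin n)) : List ℕ := List.ofFn (fun i => (π i : ℕ))

theorem toL_getD {n : ℕ} (π : Equiv.Perm (Fin n)) (i : ℕ) (h : i < n) :
    word π (i + 1) = (toL π).getD i 0 + 1 := by
  unfold word toL
  rw [dif_pos (by omega)]
  simp [List.getD, h]

theorem weight_eq {n : ℕ} (π : Equiv.Perm (Fin n)) :
    x ^ basc π * y ^ des π * s ^ suc π = lw x y s (toL π) := by
  rw [lw_eq_prod]
  have hlen : (toL π).length = n := by simp [toL]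
  rw [hlen]
  have h1 : ∏ i ∈ Finset.range (n - 1), gw x y s ((toL π).getD i 0) ((toL π).getD (i+1) 0)
      = ∏ i ∈ Finset.Icc 1 (n - 1), gw x y s (word π i) (word π (i+1)) := by
    rw [Finset.range_eq_Ico, ← Finset.Ico_succ_right_eq_Icc]
    have := Finset.prod_Ico_add' (fun i => gw x y s (word π i) (word π (i+1))) 0 (n-1) 1
    simp only [zero_add] at this
    rw [Nat.succ_eq_succ, Nat.succ_eq_add_one, ← this]
    apply Finset.prod_congr rfl
    intro i hi
    rw [Finset.mem_Ico] at hi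
    rw [toL_getD π i (by omega), toL_getD π (i+1) (by omega)]
    unfold gw
    simp
  rw [h1]
  have hp : ∀ (p : ℕ → Prop) [DecidablePred p] (z : R),
      z ^ ((Finset.Icc 1 (n-1)).filter p).card = ∏ i ∈ Finset.Icc 1 (n-1), if p i then z else 1 := by
    intro p _ z
    rw [Finset.prod_ite]; simp
  unfold basc des suc
  rw [hp, hp, hp, ← Finset.prod_mul_distrib, ← Finset.prod_mul_distrib]
  apply Finset.prod_congr rfl
  intro i hi
  rw [Finset.mem_Icc] at hi
  have hne : word π i ≠ word π (i+1) := by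
    unfold word
    rw [dif_pos (by omega), dif_pos (by omega)]
    intro h
    have h2 := π.injective (Fin.ext (Nat.succ_injective h))
    rw [Fin.mk.injEq] at h2
    omega
  unfold gw
  by_cases c1 : word π (i+1) < word π i
  · rw [if_neg (by omega), if_pos c1, if_neg (by omega), if_pos c1]; ring
  · by_cases c2 : word π (i+1) = word π i + 1
    · rw [if_neg (by omega), if_neg c1, if_pos c2, if_neg c1, if_pos c2]; ring
    · rw [if_pos (by omega), if_neg c1, if_neg c2, if_neg c1, if_neg c2]; ring

theorem toL_inj {n : ℕ} : Function.Injective (toL (n := n)) := by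
  intro π τ h
  have := List.ofFn_injective h
  ext i
  exact congrFun this i

theorem toL_perm {n : ℕ} (π : Equiv.Perm (Fin n)) : (toL π).Perm (dl n) := by
  rw [List.perm_ext_iff_of_nodup _ (nodup_dl n)]
  · intro k
    rw [mem_dl]
    unfold toL
    rw [List.mem_ofFn]
    constructor
    · rintro ⟨i, rfl⟩; exact (π i).2
    · intro h; exact ⟨π.symm ⟨k, h⟩, by simp⟩
  · unfold toL
    rw [List.nodup_ofFn]
    intro i j h
    exact π.injective (Fin.ext h)

theorem toL_surj {n : ℕ} (l : List ℕ) (h : l.Perm (dl n)) : ∃ π : Equiv.Perm (Fin n), toL π = l := by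
  have hl : l.length = n := by rw [h.length_eq, length_dl]
  have hnd : l.Nodup := h.nodup_iff.2 (nodup_dl n)
  subst hl
  have hlt : ∀ i : Fin l.length, l.get i < l.length := fun i =>
    (mem_dl _ _).1 (h.mem_iff.1 (List.get_mem _ _))
  let f : Fin l.length → Fin l.length := fun i => ⟨l.get i, hlt i⟩
  have hf : Function.Injective f := by
    intro i j hij
    exact (List.nodup_iff_injective_get.1 hnd) (Fin.mk.inj hij)
  refine ⟨Equiv.ofBijective f (Finite.injective_iff_bijective.1 hf), ?_⟩
  unfold toL
  simp [f]

theorem sum_eq_LP (n : ℕ) :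
    ∑ π : Equiv.Perm (Fin n), x ^ basc π * y ^ des π * s ^ suc π = LP x y s n := by
  classical
  unfold LP
  rw [← List.sum_toFinset _ ((List.permutations_perm_permutations' _).nodup_iff.1 (List.nodup_permutations _ (nodup_dl n)))]
  refine Finset.sum_bij (fun π _ => toL π) ?_ ?_ ?_ ?_
  · intro π _; simp [toL_perm]
  · intro a _ b _ h; exact toL_inj h
  · intro l hl
    obtain ⟨π, h⟩ := toL_surj l (by simpa using hl)
    exact ⟨π, by simp, h⟩
  · intro π _; exact weight_eq x y s π

end ring
/-! ### Insertion into cycles -/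

inductive Hit {n : ℕ} (σ : Equiv.Perm (Fin n)) (m : ℕ) : Fin n → ℕ → Prop
  | base (x : Fin n) (h : (σ x : ℕ) < m) : Hit σ m x (σ x : ℕ)
  | step (x : Fin n) (v : ℕ) (h : ¬ (σ x : ℕ) < m) (h' : Hit σ m (σ x) v) : Hit σ m x v

theorem Hit.exists_pow {n : ℕ} {σ : Equiv.Perm (Fin n)} {m : ℕ} {x : Fin n} {v : ℕ}
    (h : Hit σ m x v) : ∃ t : ℕ, 0 < t ∧ ((σ ^ t) x : ℕ) = v ∧ v < m ∧
      ∀ u, 0 < u → u < t → ¬ ((σ ^ u) x : ℕ) < m := by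
  induction h with
  | base x h => exact ⟨1, by simp, by simp, h, fun u h1 h2 => by omega⟩
  | step x v h h' ih =>
    obtain ⟨t, ht, h1, h2, h3⟩ := ih
    refine ⟨t + 1, by omega, by rw [pow_succ]; exact h1, h2, ?_⟩
    intro u hu hut
    obtain ⟨u, rfl⟩ : ∃ w, u = w + 1 := ⟨u - 1, by omega⟩
    rw [pow_succ]
    rcases Nat.eq_zero_or_pos u with rfl | hpos
    · simpa using h
    · exact h3 u hpos (by omega)

theorem Hit.nextVal_eq {n : ℕ} {σ : Equiv.Perm (Fin n)} {m : ℕ} {x : Fin n} {v : ℕ}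
    (h : Hit σ m x v) : nextVal σ m x = v := by
  classical
  obtain ⟨t, ht, h1, h2, h3⟩ := h.exists_pow
  have hex : ∃ t : ℕ, 0 < t ∧ (((σ ^ t) x : Fin n) : ℕ) < m := ⟨t, ht, by omega⟩
  unfold nextVal
  rw [dif_pos hex]
  have : Nat.find hex = t := by
    rw [Nat.find_eq_iff]
    refine ⟨⟨ht, by omega⟩, ?_⟩
    rintro u hu ⟨h4, h5⟩
    exact h3 u h4 hu h5
  rw [← h1, ← this]

theorem hit_of_pow {n : ℕ} (σ : Equiv.Perm (Fin n)) (m : ℕ) (t : ℕ) : ∀ (x : Fin n),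
    ((σ ^ (t+1)) x : ℕ) < m → ∃ v, Hit σ m x v := by
  induction t with
  | zero => intro x h; exact ⟨_, Hit.base x (by simpa using h)⟩
  | succ t ih =>
    intro x h
    by_cases h1 : (σ x : ℕ) < m
    · exact ⟨_, Hit.base x h1⟩
    · obtain ⟨v, hv⟩ := ih (σ x) (by rw [pow_succ] at h; exact h)
      exact ⟨v, Hit.step x v h1 hv⟩

theorem exists_hit {n : ℕ} (σ : Equiv.Perm (Fin n)) (m : ℕ) (x : Fin n) (h : (x : ℕ) < m) :
    ∃ v, Hit σ m x v := by
  have h0 : 0 < orderOf σ := orderOf_pos σ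
  apply hit_of_pow σ m (orderOf σ - 1) x
  rw [Nat.sub_add_cancel h0, pow_orderOf_eq_one]
  exact h

def Rel {n : ℕ} (τ : Equiv.Perm (Fin (n+1))) (σ : Equiv.Perm (Fin n)) : Prop :=
  ∀ x, τ x.castSucc = (σ x).castSucc ∨
    (τ x.castSucc = Fin.last n ∧ τ (Fin.last n) = (σ x).castSucc)

theorem Rel.inv {n : ℕ} {τ : Equiv.Perm (Fin (n+1))} {σ : Equiv.Perm (Fin n)} (h : Rel τ σ) :
    Rel τ⁻¹ σ⁻¹ := by
  intro z
  rcases h (σ⁻¹ z) with h1 | ⟨h1, h2⟩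
  · left
    rw [Equiv.Perm.inv_eq_iff_eq, h1]; simp
  · right
    rw [Equiv.Perm.inv_eq_iff_eq, Equiv.Perm.inv_eq_iff_eq, h1, h2]; simp

theorem Rel.hit {n : ℕ} {τ : Equiv.Perm (Fin (n+1))} {σ : Equiv.Perm (Fin n)} (h : Rel τ σ)
    {m : ℕ} (hm : m ≤ n) {x : Fin n} {v : ℕ} (hx : Hit σ m x v) : Hit τ m x.castSucc v := by
  induction hx with
  | base x h1 =>
    rcases h x with h2 | ⟨h2, h3⟩
    · have := Hit.base (σ := τ) (m := m) x.castSucc (by rw [h2]; simpa using h1)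
      rw [h2] at this; simpa using this
    · apply Hit.step _ _ (by rw [h2]; simp; omega)
      rw [h2]
      have := Hit.base (σ := τ) (m := m) (Fin.last n) (by rw [h3]; simpa using h1)
      rw [h3] at this; simpa using this
  | step x v h1 h1' ih =>
    rcases h x with h2 | ⟨h2, h3⟩
    · apply Hit.step _ _ (by rw [h2]; simpa using h1)
      rw [h2]; exact ih
    · apply Hit.step _ _ (by rw [h2]; simp; omega)
      rw [h2]
      apply Hit.step _ _ (by rw [h3]; simpa using h1)
      rw [h3]; exact ih

theorem Rel.nextVal {n : ℕ} {τ : Equiv.Perm (Fin (n+1))} {σ : Equiv.Perm (Fin n)} (h : Rel τ σ)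
    {m : ℕ} (hm : m ≤ n) (x : Fin n) (hx : (x : ℕ) < m) :
    nextVal τ m x.castSucc = nextVal σ m x := by
  obtain ⟨v, hv⟩ := exists_hit σ m x hx
  rw [hv.nextVal_eq, (h.hit hm hv).nextVal_eq]

theorem nextVal_top {n : ℕ} (σ : Equiv.Perm (Fin n)) (x : Fin n) : nextVal σ n x = σ x :=
  (Hit.base x (σ x).2).nextVal_eq

theorem simsun_nocda {n : ℕ} {σ : Equiv.Perm (Fin n)} (h : IsSimsun2 σ) (x : Fin n) :
    ¬ (σ⁻¹ x < x ∧ x < σ x) := by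
  have := h n le_rfl x x.2
  rw [nextVal_top, nextVal_top] at this
  exact this

theorem Rel.simsun_iff {n : ℕ} {τ : Equiv.Perm (Fin (n+1))} {σ : Equiv.Perm (Fin n)}
    (h : Rel τ σ) : IsSimsun2 τ ↔ IsSimsun2 σ ∧ ∀ x : Fin n,
      ¬ (τ⁻¹ x.castSucc < x.castSucc ∧ x.castSucc < τ x.castSucc) := by
  constructor
  · intro ht
    refine ⟨?_, fun x => simsun_nocda ht _⟩
    intro m hm x hx
    have := ht m (by omega) x.castSucc (by simpa using hx)
    rw [h.nextVal hm x hx, h.inv.nextVal hm x hx] at this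
    simpa using this
  · rintro ⟨hs, hc⟩ m hm x hx
    rcases Nat.lt_or_ge n m with h1 | h1
    · obtain rfl : m = n + 1 := by omega
      rw [nextVal_top, nextVal_top]
      induction x using Fin.lastCases with
      | last =>
        rintro ⟨_, h3⟩
        have := (τ (Fin.last n)).2
        simp at h3; omega
      | cast x => exact hc x
    · induction x using Fin.lastCases with
      | last => simp at hx; omega
      | cast x =>
        rw [h.nextVal h1 x (by simpa using hx), h.inv.nextVal h1 x (by simpa using hx)]
        simpa using hs m h1 x (by simpa using hx)

def EQ (n : ℕ) : Option (Fin n) × Equiv.Perm (Fin n) ≃ Equiv.Perm (Fin (n+1)) :=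
  Equiv.Perm.decomposeOption.symm.trans (finSuccEquivLast (n := n)).symm.permCongr

theorem EQ_none_cast {n : ℕ} (σ : Equiv.Perm (Fin n)) (x : Fin n) :
    EQ n (none, σ) x.castSucc = (σ x).castSucc := by
  simp [EQ]

theorem EQ_none_last {n : ℕ} (σ : Equiv.Perm (Fin n)) :
    EQ n (none, σ) (Fin.last n) = Fin.last n := by
  simp [EQ]

theorem EQ_some_cast {n : ℕ} (σ : Equiv.Perm (Fin n)) (i x : Fin n) :
    EQ n (some (σ i), σ) x.castSucc = if x = i then Fin.last n else (σ x).castSucc := by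
  simp only [EQ, Equiv.trans_apply, Equiv.permCongr_apply, Equiv.symm_symm,
    finSuccEquivLast_castSucc, Equiv.Perm.decomposeOption_symm_apply, Equiv.Perm.mul_apply,
    Equiv.optionCongr_apply, Option.map_some]
  split_ifs with h
  · subst h; simp
  · rw [Equiv.swap_apply_of_ne_of_ne (by simp) (by simp [h])]; simp

theorem EQ_some_last {n : ℕ} (σ : Equiv.Perm (Fin n)) (i : Fin n) :
    EQ n (some (σ i), σ) (Fin.last n) = (σ i).castSucc := by
  simp [EQ]

theorem rel_none {n : ℕ} (σ : Equiv.Perm (Fin n)) : Rel (EQ n (none, σ)) σ :=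
  fun x => Or.inl (EQ_none_cast σ x)

theorem rel_some {n : ℕ} (σ : Equiv.Perm (Fin n)) (i : Fin n) : Rel (EQ n (some (σ i), σ)) σ := by
  intro x
  rw [EQ_some_cast, EQ_some_last]
  by_cases h : x = i
  · subst h; simp
  · simp [h]

theorem simsun_none {n : ℕ} (σ : Equiv.Perm (Fin n)) :
    IsSimsun2 (EQ n (none, σ)) ↔ IsSimsun2 σ := by
  rw [(rel_none σ).simsun_iff]
  refine ⟨fun h => h.1, fun h => ⟨h, fun x => ?_⟩⟩
  have h1 : (EQ n (none, σ))⁻¹ x.castSucc = (σ⁻¹ x).castSucc := by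
    rw [Equiv.Perm.inv_eq_iff_eq, EQ_none_cast]; simp
  rw [h1, EQ_none_cast]
  simpa using simsun_nocda h x

theorem simsun_some {n : ℕ} (σ : Equiv.Perm (Fin n)) (i : Fin n) :
    IsSimsun2 (EQ n (some (σ i), σ)) ↔ IsSimsun2 σ ∧ i ≤ σ⁻¹ i := by
  rw [(rel_some σ i).simsun_iff]
  have h1 : ∀ x, (EQ n (some (σ i), σ))⁻¹ x.castSucc =
      if σ⁻¹ x = i then Fin.last n else (σ⁻¹ x).castSucc := by
    intro x
    rw [Equiv.Perm.inv_eq_iff_eq]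
    split_ifs with h
    · rw [EQ_some_last, ← h]; simp
    · rw [EQ_some_cast, if_neg h]; simp
  refine and_congr_right fun hs => ⟨fun h => ?_, fun h x => ?_⟩
  · by_contra hc
    push Not at hc
    apply h i
    rw [h1, if_neg hc.ne, EQ_some_cast, if_pos rfl]
    exact ⟨by simpa using hc, Fin.castSucc_lt_last i⟩
  · rw [h1, EQ_some_cast]
    rintro ⟨h2, h3⟩
    split_ifs at h2 h3 with c1 c2 c2
    · exact absurd h2 (not_lt.2 (Fin.le_last _))
    · exact absurd h2 (not_lt.2 (Fin.le_last _))
    · subst c2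
      exact absurd h2 (by simpa using h)
    · exact simsun_nocda hs x ⟨by simpa using h2, by simpa using h3⟩

theorem card_split {n : ℕ} (p : Fin (n+1) → Prop) [DecidablePred p] :
    (Finset.univ.filter p).card
      = (Finset.univ.filter fun x : Fin n => p x.castSucc).card
        + if p (Fin.last n) then 1 else 0 := by
  rw [Finset.card_filter, Finset.card_filter, Fin.sum_univ_castSucc]

theorem exc_none {n : ℕ} (σ : Equiv.Perm (Fin n)) : excStat (EQ n (none, σ)) = excStat σ := by
  unfold excStat
  rw [card_split]
  simp [EQ_none_cast, EQ_none_last]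

theorem fix_none {n : ℕ} (σ : Equiv.Perm (Fin n)) : fixStat (EQ n (none, σ)) = fixStat σ + 1 := by
  unfold fixStat
  rw [card_split]
  simp [EQ_none_cast, EQ_none_last]

theorem exc_some {n : ℕ} (σ : Equiv.Perm (Fin n)) (i : Fin n) :
    excStat (EQ n (some (σ i), σ)) = excStat σ + if i < σ i then 0 else 1 := by
  unfold excStat
  rw [card_split, EQ_some_last, if_neg (not_lt.2 (Fin.le_last _))]
  have : (Finset.univ.filter fun x : Fin n => x.castSucc < EQ n (some (σ i), σ) x.castSucc)
      = insert i (Finset.univ.filter fun x : Fin n => x < σ x) := by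
    ext x
    simp only [Finset.mem_filter, Finset.mem_univ, true_and, Finset.mem_insert, EQ_some_cast]
    by_cases h : x = i
    · simp [h, Fin.castSucc_lt_last]
    · simp [h]
  rw [this]
  by_cases h : i < σ i
  · rw [Finset.insert_eq_of_mem (by simpa using h)]; simp [h]
  · rw [Finset.card_insert_of_notMem (by simpa using h)]; simp [h]

theorem fix_some {n : ℕ} (σ : Equiv.Perm (Fin n)) (i : Fin n) :
    fixStat (EQ n (some (σ i), σ)) = fixStat σ - if σ i = i then 1 else 0 := by
  unfold fixStat
  rw [card_split, EQ_some_last, if_neg (Fin.castSucc_lt_last _).ne]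
  have : (Finset.univ.filter fun x : Fin n => EQ n (some (σ i), σ) x.castSucc = x.castSucc)
      = (Finset.univ.filter fun x : Fin n => σ x = x).erase i := by
    ext x
    simp only [Finset.mem_filter, Finset.mem_univ, true_and, Finset.mem_erase, EQ_some_cast]
    by_cases h : x = i
    · simp [h, (Fin.castSucc_lt_last i).ne']
    · simp [h]
  rw [this]
  by_cases h : σ i = i
  · rw [Finset.card_erase_of_mem (by simpa using h)]; simp [h]
  · rw [Finset.erase_eq_of_notMem (by simpa using h)]; simp [h]

/-- cycle double descents -/
def cdd {n : ℕ} (σ : Equiv.Perm (Fin n)) : ℕ :=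
  (Finset.univ.filter fun i : Fin n => i < σ⁻¹ i ∧ σ i < i).card

theorem count_types {n : ℕ} {σ : Equiv.Perm (Fin n)} (h : IsSimsun2 σ) :
    fixStat σ + 2 * excStat σ + cdd σ = n := by
  have hpk : excStat σ = (Finset.univ.filter fun i : Fin n => σ⁻¹ i < i).card := by
    unfold excStat
    apply Finset.card_bij (fun i _ => σ i)
    · intro i hi; simpa using hi
    · intro a _ b _ hab; exact σ.injective hab
    · intro b hb; exact ⟨σ⁻¹ b, by simpa using hb, by simp⟩
  have e : n = ∑ _i : Fin n, 1 := by simp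
  rw [two_mul]
  nth_rewrite 2 [hpk]
  unfold fixStat excStat cdd
  conv_rhs => rw [e]
  simp only [Finset.card_filter, ← Finset.sum_add_distrib]
  apply Finset.sum_congr rfl
  intro i _
  have h1 := simsun_nocda h i
  have h2 : σ i = i ↔ σ⁻¹ i = i := by rw [Equiv.Perm.inv_eq_iff_eq, eq_comm]
  rcases lt_trichotomy (σ i) i with c | c | c
  · have : σ⁻¹ i ≠ i := fun hh => c.ne (h2.2 hh)
    rcases lt_or_gt_of_ne this with d | d
    · generalize σ⁻¹ i = j at d ⊢; simp [c, c.ne, not_lt.2 c.le, d, not_lt.2 d.le]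
    · generalize σ⁻¹ i = j at d ⊢; simp [c, c.ne, not_lt.2 c.le, d, not_lt.2 d.le]
  · have := h2.1 c
    simp [c, this]
  · have h3 : ¬ σ⁻¹ i < i := fun hh => h1 ⟨hh, c⟩
    generalize σ⁻¹ i = j at h3 ⊢; simp [c, c.ne', not_lt.2 c.le, not_lt.1 h3]

section ring2
variable {R : Type*} [CommRing R] [Algebra ℝ R] (D : Derivation ℝ R R) (q t s : R)

def W {n : ℕ} (σ : Equiv.Perm (Fin n)) : R :=
  q ^ fixStat σ * t ^ excStat σ * s ^ (n - fixStat σ - 2 * excStat σ)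

noncomputable def SP (n : ℕ) : R := ∑ σ : Equiv.Perm (Fin n), if IsSimsun2 σ then W q t s σ else 0

theorem inner_sum (hq : D q = t) (ht : D t = s * t) (hs : D s = t) {n : ℕ}
    {σ : Equiv.Perm (Fin n)} (h : IsSimsun2 σ) :
    ∑ i : Fin n, (if i ≤ σ⁻¹ i then W q t s (EQ n (some (σ i), σ)) else 0) = D (W q t s σ) := by
  have hc := count_types h
  have hval : ∀ i : Fin n, i < σ i → i ≤ σ⁻¹ i := fun i hi => by
    by_contra hcon
    exact simsun_nocda h i ⟨not_le.1 hcon, hi⟩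
  have h2 : ∀ i, σ i = i ↔ σ⁻¹ i = i := fun i => by rw [Equiv.Perm.inv_eq_iff_eq, eq_comm]
  have hterm : ∀ i : Fin n, (if i ≤ σ⁻¹ i then W q t s (EQ n (some (σ i), σ)) else 0)
      = (if σ i = i then q ^ (fixStat σ - 1) * t ^ (excStat σ + 1) * s ^ cdd σ else 0)
        + (if i < σ i then q ^ fixStat σ * t ^ excStat σ * s ^ (cdd σ + 1) else 0)
        + (if i < σ⁻¹ i ∧ σ i < i then
            q ^ fixStat σ * t ^ (excStat σ + 1) * s ^ (cdd σ - 1) else 0) := by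
    intro i
    unfold W
    rw [fix_some, exc_some]
    rcases lt_trichotomy (σ i) i with c | c | c
    · have : σ⁻¹ i ≠ i := fun hh => c.ne ((h2 i).2 hh)
      rcases lt_or_gt_of_ne this with d | d
      · generalize σ⁻¹ i = j at d ⊢; simp [c.ne, not_lt.2 c.le, not_le.2 d, not_lt.2 d.le]
      · have hn : n + 1 - fixStat σ - 2 * (excStat σ + 1) = cdd σ - 1 := by omega
        generalize σ⁻¹ i = j at d ⊢; simp [c, c.ne, not_lt.2 c.le, d, d.le, hn]
    · have d := (h2 i).1 c
      have hpos : 0 < fixStat σ := Finset.card_pos.2 ⟨i, by simpa using c⟩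
      have hn : n + 1 - (fixStat σ - 1) - 2 * (excStat σ + 1) = cdd σ := by omega
      simp [c, d, hn]
    · have hn : n + 1 - fixStat σ - 2 * (excStat σ) = cdd σ + 1 := by omega
      have d := hval i c
      generalize σ⁻¹ i = j at d ⊢; simp [c, c.ne', not_lt.2 c.le, d, hn]
  simp only [hterm, Finset.sum_add_distrib]
  have hn : n - fixStat σ - 2 * (excStat σ) = cdd σ := by omega
  have hcnt : ∀ (p : Fin n → Prop) [DecidablePred p] (z : R),
      (∑ i : Fin n, if p i then z else 0) = ((Finset.univ.filter p).card : R) * z := by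
    intro p _ z
    rw [← Finset.sum_filter]; simp
  rw [hcnt, hcnt, hcnt]
  change (fixStat σ : R) * _ + (excStat σ : R) * _ + (cdd σ : R) * _ = _
  unfold W
  rw [hn]
  have het : (excStat σ : R) * t ^ (excStat σ - 1) * t = excStat σ * t ^ excStat σ := by
    rcases Nat.eq_zero_or_pos (excStat σ) with h0 | h0
    · simp [h0]
    · rw [mul_assoc, ← pow_succ, Nat.sub_add_cancel h0]
  simp only [D.leibniz, D.leibniz_pow, smul_eq_mul, nsmul_eq_mul, hq, ht, hs]
  linear_combination (-(s * q ^ fixStat σ * s ^ cdd σ)) * het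

theorem SP_rec (hq : D q = t) (ht : D t = s * t) (hs : D s = t) (n : ℕ) :
    SP q t s (n + 1) = D (SP q t s n) + q * SP q t s n := by
  unfold SP
  rw [← (EQ n).sum_comp, Fintype.sum_prod_type_right, map_sum, Finset.mul_sum,
    ← Finset.sum_add_distrib]
  apply Finset.sum_congr rfl
  intro σ _
  rw [Fintype.sum_option]
  rw [← Equiv.sum_comp σ]
  simp only [simsun_some, simsun_none]
  by_cases h : IsSimsun2 σ
  · simp only [h, true_and, if_true]
    rw [inner_sum D q t s hq ht hs h]
    have hc := count_types h
    unfold W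
    rw [fix_none, exc_none]
    have hn : n + 1 - (fixStat σ + 1) - 2 * excStat σ = n - fixStat σ - 2 * excStat σ := by omega
    rw [hn]; ring
  · simp [h]

end ring2

theorem LP_eq_SP {R : Type*} [CommRing R] [Algebra ℝ R] (D : Derivation ℝ R R) (x y s : R)
    (hx : D x = x * y) (hy : D y = x * y) (hs : D s = x * y) (n : ℕ) :
    LP x y s (n + 1) = SP (y + s) (2 * x * y) (x + y) n := by
  induction n with
  | zero =>
    have hz : ∀ σ : Equiv.Perm (Fin 0), IsSimsun2 σ := fun σ m _ x => x.elim0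
    simp [LP, dl, lw, SP, W, hz, fixStat, excStat]
  | succ n ih =>
    rw [LP_rec D x y s hx hy hs, ih]
    have h2 : D 2 = 0 := by
      have := D.map_natCast 2
      simpa using this
    refine (SP_rec D _ _ _ ?_ ?_ ?_ n).symm
    · rw [map_add, hy, hs]; ring
    · simp only [D.leibniz, hx, hy, h2, smul_eq_mul]; ring
    · rw [map_add, hx, hy]; ring

theorem main_gen_s5 (n : ℕ) (x y s : ℝ) :
    ∑ π : Equiv.Perm (Fin (n + 1)), x ^ basc π * y ^ des π * s ^ suc π =
      ∑ σ : Equiv.Perm (Fin n), if IsSimsun2 σ then W (y + s) (2 * x * y) (x + y) σ else 0 := by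
  let X : Fin 3 → MvPolynomial (Fin 3) ℝ := MvPolynomial.X
  let D : Derivation ℝ (MvPolynomial (Fin 3) ℝ) (MvPolynomial (Fin 3) ℝ) :=
    MvPolynomial.mkDerivation ℝ (fun _ => X 0 * X 1)
  have hD : ∀ i, D (X i) = X 0 * X 1 := fun i => MvPolynomial.mkDerivation_X _ _ _
  have h := LP_eq_SP D (X 0) (X 1) (X 2) (hD 0) (hD 1) (hD 2) n
  rw [← sum_eq_LP] at h
  have h' := congrArg (MvPolynomial.eval ![x, y, s]) h
  unfold SP W at h'
  unfold W
  simpa [X, apply_ite (MvPolynomial.eval ![x, y, s])] using h'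

/-- `Σ_{π ∈ S_{n+1}} x^basc y^des (-y)^suc
= Σ_{σ ∈ SS_n, fix σ = 0} (2xy)^exc (x+y)^(n - 2 exc)`. -/
theorem statement5 (n : ℕ) (x y : ℝ) :
    ∑ π : Equiv.Perm (Fin (n + 1)), x ^ basc π * y ^ des π * (-y) ^ suc π =
      ∑ σ ∈ Finset.univ.filter fun σ : Equiv.Perm (Fin n) => IsSimsun2 σ ∧ fixStat σ = 0,
        (2 * x * y) ^ excStat σ * (x + y) ^ (n - 2 * excStat σ) := by
  rw [main_gen_s5, Finset.sum_filter]
  apply Finset.sum_congr rfl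
  intro σ _
  unfold W
  by_cases h : IsSimsun2 σ
  · by_cases h0 : fixStat σ = 0
    · simp [h, h0]
    · simp [h, h0]
  · simp [h]

end SucEuler
end
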